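/- Let $q$ be a primitive $N$-th root of unity, $b \in \mathbb{Z}$, and $\xi_b(i,j,k) = q^{b k \lfloor (i+j)/N \rfloor}$ for $0 \le i,j,k < N$. Then the cohomology classes of $\xi_b$ and $\xi_{b'}$ in $H^3(\mathbb{Z}/N\mathbb{Z}, \mathbb{C}^\times)$ are equal if and only if $b \equiv b' \pmod N$; in particular the map $b \mapsto [\xi_b]$ gives an isomorphism $\mathbb{Z}/N\mathbb{Z} \cong H^3(\mathbb{Z}/N\mathbb{Z}, \mathbb{C}^\times)$. -/

import Mathlib

/-- A primitive `N`-th root of unity identifies `ℤ/N` with the `N`-torsion of `Rˣ`. -/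
noncomputable def IsPrimitiveRoot.zmodEquivTorsion {R : Type*} [CommRing R] [IsDomain R]
    {N : ℕ} [NeZero N] {ζ : Rˣ} (h : IsPrimitiveRoot ζ N) :
    ZMod N ≃+ AddMonoidHom.ker (nsmulAddMonoidHom (α := Additive Rˣ) N) :=
  h.zmodEquivZPowers.trans <| (MulEquiv.subgroupCongr h.zpowers_eq).toAdditive.trans
    { toFun x := ⟨.ofMul x.toMul.1, x.toMul.2⟩
      invFun x := .ofMul ⟨x.1.toMul, x.2⟩
      left_inv _ := rfl
      right_inv _ := rfl
      map_add' _ _ := rfl }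

open CategoryTheory Rep.FiniteCyclicGroup in
/-- For a finite cyclic group of order `N` acting trivially on `V`, the odd cohomology is the
`N`-torsion of `V`. -/
theorem groupCohomology_trivial_odd_addEquiv {G V : Type} [CommGroup G] [Finite G] [IsCyclic G]
    [AddCommGroup V] {i : ℕ} (hi : Odd i) :
    Nonempty ((AddMonoidHom.ker (nsmulAddMonoidHom (α := V) (Nat.card G))) ≃+
      groupCohomology (Rep.trivial ℤ G V) i) := by
  have := Fintype.ofFinite G
  obtain ⟨g, hg⟩ := IsCyclic.exists_generator (α := G)
  let A := Rep.trivial ℤ G V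
  have hnorm (x : V) : A.norm.hom x = Nat.card G • x := by
    rw [Rep.norm_apply]
    simp [A, Representation.norm, Nat.card_eq_fintype_card]
  have hsub (x : V) : (Rep.applyAsHom A g - 𝟙 A).hom.toLinearMap x = 0 := by
    simp [A, Rep.sub_hom, Rep.applyAsHom]
  have hinj : Function.Injective (groupCohomologyπOdd A g hg i hi) := by
    refine (injective_iff_map_eq_zero _).2 fun x hx => ?_
    obtain ⟨y, hy⟩ := (groupCohomologyπOdd_eq_zero_iff A g hg i hi x).1 hx
    exact Subtype.ext (hy.symm.trans (hsub y))
  have hsurj : Function.Surjective (groupCohomologyπOdd A g hg i hi) :=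
    (ModuleCat.epi_iff_surjective _).1 <|
      have : Epi ((subCompNormHom A g).homologyπ ≫ (groupCohomologyIsoOdd A g hg i hi).inv) :=
        epi_comp _ _
      have : Epi (subCompNormHom A g).moduleCatCyclesIso.inv := inferInstance
      epi_comp (subCompNormHom A g).moduleCatCyclesIso.inv _
  let e : AddMonoidHom.ker (nsmulAddMonoidHom (α := V) (Nat.card G)) ≃+
      LinearMap.ker A.norm.hom.toLinearMap :=
    { toFun x := ⟨x.1, (hnorm x.1).trans x.2⟩
      invFun x := ⟨x.1, (hnorm x.1).symm.trans x.2⟩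
      left_inv _ := rfl
      right_inv _ := rfl
      map_add' _ _ := rfl }
  exact ⟨e.trans (AddEquiv.ofBijective (groupCohomologyπOdd A g hg i hi).hom ⟨hinj, hsurj⟩)⟩

/-- The product of a 3-coboundary `dκ(g, j, g)` over all `j` is trivial. -/
theorem prod_threeCoboundary_eq_one {G M : Type*} [AddCommGroup G] [Fintype G] [CommGroup M]
    (κ : G → G → M) (g : G) :
    ∏ j, (κ j g * (κ (g + j) g)⁻¹ * κ g (j + g) * (κ g j)⁻¹) = 1 := by
  simp only [Finset.prod_mul_distrib, Finset.prod_inv_distrib]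
  rw [Fintype.prod_equiv (Equiv.addLeft g) (fun j => κ (g + j) g) (fun j => κ j g) fun _ => rfl,
    Fintype.prod_equiv (Equiv.addRight g) (fun j => κ g (j + g)) (fun j => κ g j) fun _ => rfl]
  simp

/-- Summing the carry of `1 + j` over all residues `j` gives `1`. -/
theorem ZMod.sum_one_add_val_div {N : ℕ} [Fact (1 < N)] [NeZero N] :
    ∑ j : ZMod N, ((1 : ZMod N).val + j.val) / N = 1 := by
  have hN : 1 < N := Fact.out
  obtain ⟨n, rfl⟩ : ∃ n, N = n + 1 := ⟨N - 1, by omega⟩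
  rw [ZMod.val_one]
  change ∑ j : Fin (n + 1), (1 + j.val) / (n + 1) = 1
  rw [Fin.sum_univ_castSucc, Finset.sum_eq_zero fun j _ => Nat.div_eq_of_lt (by simp; omega)]
  simp [add_comm 1 n]

/-- The explicit 3-cochains `ξ_b(i,j,k) = q^{bk⌊(i+j)/N⌋}` on `ℤ/Nℤ` (for `q` a primitive
`N`-th root of unity) are cohomologous if and only if `b ≡ b' (mod N)`; in particular
`b ↦ [ξ_b]` realizes the isomorphism `ℤ/Nℤ ≅ H³(ℤ/Nℤ, ℂˣ)`. -/
theorem stmt_13 (N : ℕ) [NeZero N] (q : ℂ) (hq : IsPrimitiveRoot q N)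
    (ξ : ℤ → ZMod N → ZMod N → ZMod N → ℂ)
    (hξ : ∀ (b : ℤ) (i j k : ZMod N),
      ξ b i j k = q ^ (b * (k.val : ℤ) * (((i.val + j.val) / N : ℕ) : ℤ))) :
    (∀ b b' : ℤ,
      (∃ κ : ZMod N → ZMod N → ℂ, (∀ i j : ZMod N, κ i j ≠ 0) ∧
        ∀ i j k : ZMod N,
          ξ b i j k = ξ b' i j k * κ j k * (κ (i + j) k)⁻¹ * κ i (j + k) * (κ i j)⁻¹)
      ↔ (b : ZMod N) = (b' : ZMod N)) ∧
    Nonempty (ZMod N ≃+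
      groupCohomology (Rep.trivial ℤ (Multiplicative (ZMod N)) (Additive ℂˣ)) 3) := by
  have hq0 : q ≠ 0 := hq.ne_zero (NeZero.ne N)
  refine ⟨fun b b' => ⟨?_, fun hb => ?_⟩, ?_⟩
  · rintro ⟨κ, hκ, h⟩
    obtain hN | hN := (Nat.one_le_iff_ne_zero.2 (NeZero.ne N)).eq_or_lt
    · subst hN
      exact Subsingleton.elim _ _
    have : Fact (1 < N) := ⟨hN⟩
    have hprod (c : ℤ) : ∏ j, ξ c 1 j 1 = q ^ c := by
      simp only [hξ, ZMod.val_one N, Nat.cast_one, mul_one, zpow_mul, zpow_natCast]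
      have := ZMod.sum_one_add_val_div (N := N)
      rw [ZMod.val_one] at this
      rw [Finset.prod_pow_eq_pow_sum, this, pow_one]
    have hκ' := congrArg Units.val
      (prod_threeCoboundary_eq_one (fun i j => Units.mk0 (κ i j) (hκ i j)) (1 : ZMod N))
    simp only [Units.coe_prod, Units.val_mul, Units.val_inv_eq_inv_val, Units.val_mk0,
      Units.val_one] at hκ'
    have hbb : q ^ b = q ^ b' := by
      rw [← hprod, ← hprod, ← mul_one (∏ j, ξ b' 1 j 1), ← hκ', ← Finset.prod_mul_distrib]
      exact Finset.prod_congr rfl fun j _ => by rw [h]; ring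
    rw [ZMod.intCast_eq_intCast_iff_dvd_sub, ← hq.zpow_eq_one_iff_dvd, zpow_sub₀ hq0, hbb,
      div_self (zpow_ne_zero _ hq0)]
  · refine ⟨fun _ _ => 1, by simp, fun i j k => ?_⟩
    have hbb : q ^ b = q ^ b' := by
      rw [ZMod.intCast_eq_intCast_iff_dvd_sub, ← hq.zpow_eq_one_iff_dvd, zpow_sub₀ hq0,
        div_eq_one_iff_eq (zpow_ne_zero _ hq0)] at hb
      exact hb.symm
    simp [hξ, zpow_mul, hbb]
  · obtain ⟨e⟩ := groupCohomology_trivial_odd_addEquiv (G := Multiplicative (ZMod N))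
      (V := Additive ℂˣ) (i := 3) (by decide)
    rw [Nat.card_congr Multiplicative.toAdd, Nat.card_zmod] at e
    exact ⟨(hq.isUnit_unit (NeZero.ne N)).zmodEquivTorsion.trans e⟩
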